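/- arXiv:2406.14078 — 3 statements merged into one kernel-verified Lean document; each statement's English description precedes it below -/
import Mathlib

section
/- Let n ≥ 2 and fix numbers m, d ≥ 2 of inputs and outcomes per party. Let G be a finite family of subsets g ⊆ {1,…,n} with |g| ≥ 2, and for each g ∈ G let I^g be a Bell expression such that (i) for every bipartition S|S̄ of {1,…,n} and every n-partite correlation p that is local across S|S̄, if there exist i, j ∈ g with i ∈ S and j ∈ S̄ then I^g(p) ≤ 0, and (ii) all the I^g have the same positive part I₊. Let T be a Bell expression with nonnegative coefficients such that, coefficientwise, T ≤ I₋^g for every g ∈ G. Then for every fixed bipartition S|S̄ and every correlation p that is local across S|S̄, one has ∑_{g∈G} I^g(p) ≤ |G'|·(I₊(p) − T(p)), where G' = {g ∈ G : g ⊆ S or g ⊆ S̄}. -/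
/-- A non-signaling correlation with `d` outcomes and `m` inputs per party, for a
finite set `ι` of parties: nonnegative, normalized, and non-signaling. -/
def IsNSCorr {ι : Type} [Fintype ι] [DecidableEq ι] (d m : ℕ)
    (p : (ι → Fin d) → (ι → Fin m) → ℝ) : Prop :=
  (∀ a x, 0 ≤ p a x) ∧ (∀ x, ∑ a : ι → Fin d, p a x = 1) ∧
  (∀ (i : ι) (a : ι → Fin d) (x x' : ι → Fin m), (∀ j, j ≠ i → x j = x' j) →
    ∑ v : Fin d, p (Function.update a i v) x = ∑ v : Fin d, p (Function.update a i v) x')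

/-- `p` is local across the bipartition `S | Sᶜ` of the `n` parties. -/
def IsLocalAcross (n d m : ℕ) (S : Finset (Fin n))
    (p : (Fin n → Fin d) → (Fin n → Fin m) → ℝ) : Prop :=
  ∃ (N : ℕ) (q : Fin N → ℝ)
    (pS : Fin N → ({i : Fin n // i ∈ S} → Fin d) → ({i : Fin n // i ∈ S} → Fin m) → ℝ)
    (pT : Fin N → ({i : Fin n // i ∉ S} → Fin d) → ({i : Fin n // i ∉ S} → Fin m) → ℝ),
    (∀ l, 0 ≤ q l) ∧ (∑ l, q l = 1) ∧
    (∀ l, IsNSCorr d m (pS l)) ∧ (∀ l, IsNSCorr d m (pT l)) ∧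
    (∀ a x, p a x =
      ∑ l, q l * pS l (fun i => a i.1) (fun i => x i.1) * pT l (fun i => a i.1) (fun i => x i.1))

/-- `p` is bilocal: a convex combination of correlations, each local across some
nontrivial bipartition. -/
def IsBilocal (n d m : ℕ) (p : (Fin n → Fin d) → (Fin n → Fin m) → ℝ) : Prop :=
  ∃ (N : ℕ) (q : Fin N → ℝ)
    (ps : Fin N → (Fin n → Fin d) → (Fin n → Fin m) → ℝ) (S : Fin N → Finset (Fin n)),
    (∀ l, 0 ≤ q l) ∧ (∑ l, q l = 1) ∧
    (∀ l, (S l).Nonempty ∧ S l ≠ Finset.univ ∧ IsLocalAcross n d m (S l) (ps l)) ∧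
    (∀ a x, p a x = ∑ l, q l * ps l a x)

/-- `p` is a mixture of products over the blocks (the fibers) of the partition
function `π`. -/
def IsProdForPartition (n d m : ℕ) (π : Fin n → Fin n)
    (p : (Fin n → Fin d) → (Fin n → Fin m) → ℝ) : Prop :=
  ∃ (N : ℕ) (q : Fin N → ℝ)
    (pB : Fin N → (t : Fin n) →
      ({i : Fin n // π i = t} → Fin d) → ({i : Fin n // π i = t} → Fin m) → ℝ),
    (∀ l, 0 ≤ q l) ∧ (∑ l, q l = 1) ∧
    (∀ l t, IsNSCorr d m (pB l t)) ∧
    (∀ a x, p a x = ∑ l, q l * ∏ t : Fin n, pB l t (fun i => a i.1) (fun i => x i.1))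

/-- `p` is `k`-producible: a convex combination of correlations, each a mixture of
products over the blocks of a partition of the parties into blocks of size at most `k`. -/
def IsKProducible (n d m k : ℕ) (p : (Fin n → Fin d) → (Fin n → Fin m) → ℝ) : Prop :=
  ∃ (N : ℕ) (q : Fin N → ℝ)
    (ps : Fin N → (Fin n → Fin d) → (Fin n → Fin m) → ℝ) (π : Fin N → (Fin n → Fin n)),
    (∀ l, 0 ≤ q l) ∧ (∑ l, q l = 1) ∧
    (∀ l, (∀ t, (Finset.univ.filter (fun i => π l i = t)).card ≤ k) ∧
      IsProdForPartition n d m (π l) (ps l)) ∧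
    (∀ a x, p a x = ∑ l, q l * ps l a x)

/-- The value of the Bell expression with coefficients `β` on the correlation `p`. -/
def BellApply {n d m : ℕ} (β : (Fin n → Fin d) → (Fin n → Fin m) → ℝ)
    (p : (Fin n → Fin d) → (Fin n → Fin m) → ℝ) : ℝ :=
  ∑ a, ∑ x, β a x * p a x

/-- A correlation local across a bipartition has nonnegative entries. -/
theorem IsLocalAcross.nonneg {n d m : ℕ} {S : Finset (Fin n)}
    {p : (Fin n → Fin d) → (Fin n → Fin m) → ℝ} (hp : IsLocalAcross n d m S p)
    (a : Fin n → Fin d) (x : Fin n → Fin m) : 0 ≤ p a x := by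
  obtain ⟨N, q, pS, pT, hq, -, hS, hT, h⟩ := hp
  rw [h]
  exact Finset.sum_nonneg fun l _ =>
    mul_nonneg (mul_nonneg (hq l) ((hS l).1 _ _)) ((hT l).1 _ _)

/-- A Bell expression is bounded by its positive part minus any lower bound of its negative
part, on every nonnegative `p`. -/
theorem bellApply_le_sub {n d m : ℕ} {β β' T p : (Fin n → Fin d) → (Fin n → Fin m) → ℝ}
    (hβ : ∀ a x, max (β a x) 0 = β' a x) (hT : ∀ a x, T a x ≤ max (-(β a x)) 0)
    (hp : ∀ a x, 0 ≤ p a x) :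
    BellApply β p ≤ BellApply β' p - BellApply T p := by
  simp only [BellApply, ← Finset.sum_sub_distrib, ← sub_mul]
  refine Finset.sum_le_sum fun a _ => Finset.sum_le_sum fun x _ =>
    mul_le_mul_of_nonneg_right ?_ (hp a x)
  rw [← hβ a x, le_sub_comm]
  refine (hT a x).trans (max_le ?_ ?_) <;>
    linarith [le_max_left (β a x) 0, le_max_right (β a x) 0]

/-- Under the same assumptions on the family `I^g = β g` and on `T`,
for a fixed bipartition `S|Sᶜ` and any correlation `p` local across it,
`∑_{g ∈ G} I^g(p) ≤ |G'| (I₊(p) - T(p))` where `G' = {g ∈ G : g ⊆ S ∨ g ⊆ Sᶜ}`. -/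
theorem statement1 (n m d : ℕ) (hn : 2 ≤ n) (hm : 2 ≤ m) (hd : 2 ≤ d)
    (G : Finset (Finset (Fin n))) (hG : ∀ g ∈ G, 2 ≤ g.card)
    (β : Finset (Fin n) → (Fin n → Fin d) → (Fin n → Fin m) → ℝ)
    (Iplus : (Fin n → Fin d) → (Fin n → Fin m) → ℝ)
    (hIplus : ∀ g ∈ G, ∀ a x, max (β g a x) 0 = Iplus a x)
    (hloc : ∀ g ∈ G, ∀ S : Finset (Fin n), S.Nonempty → S ≠ Finset.univ →
      ∀ p : (Fin n → Fin d) → (Fin n → Fin m) → ℝ, IsLocalAcross n d m S p →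
        (∃ i ∈ g, i ∈ S) → (∃ j ∈ g, j ∉ S) → BellApply (β g) p ≤ 0)
    (T : (Fin n → Fin d) → (Fin n → Fin m) → ℝ)
    (hT0 : ∀ a x, 0 ≤ T a x)
    (hT : ∀ g ∈ G, ∀ a x, T a x ≤ max (-(β g a x)) 0)
    (S : Finset (Fin n)) (hS : S.Nonempty) (hS' : S ≠ Finset.univ)
    (p : (Fin n → Fin d) → (Fin n → Fin m) → ℝ)
    (hp : IsLocalAcross n d m S p) :
    ∑ g ∈ G, BellApply (β g) p ≤
      (((G.filter (fun g => g ⊆ S ∨ g ⊆ Sᶜ)).card : ℕ) : ℝ) *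
        (BellApply Iplus p - BellApply T p) := by
  rw [← Finset.sum_filter_add_sum_filter_not G (fun g => g ⊆ S ∨ g ⊆ Sᶜ), ← nsmul_eq_mul]
  refine (add_le_add (Finset.sum_le_card_nsmul _ _ (BellApply Iplus p - BellApply T p) ?_)
    (Finset.sum_nonpos ?_)).trans_eq (add_zero _)
  · intro g hg
    have hgG := (Finset.mem_filter.mp hg).1
    exact bellApply_le_sub (hIplus g hgG) (hT g hgG) hp.nonneg
  · intro g hg
    obtain ⟨hgG, hcut⟩ := Finset.mem_filter.mp hg
    obtain ⟨hgS, hgSc⟩ := not_or.mp hcut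
    obtain ⟨j, hj, hjS⟩ := Finset.not_subset.mp hgS
    obtain ⟨i, hi, hiS⟩ := Finset.not_subset.mp hgSc
    exact hloc g hgG S hS hS' p hp ⟨i, hi, by simpa using hiS⟩ ⟨j, hj, hjS⟩
end

section
/- Let n ≥ 2 and 1 ≤ k ≤ n. Every k-producible n-partite correlation p with 2 inputs and 2 outcomes per party satisfies ∑_{j=2}^{n} I^{1,j}_{0|0}(p) ≤ (k−1)·[p(0|0) − p(e_1|e_1)], where 0 is the all-zero tuple and e_1 = (1,0,…,0). -/
/-- The outcome/input tuple with a single `1` at position `i` and `0` elsewhere. -/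
def unitVec (n : ℕ) (i : Fin n) : Fin n → Fin 2 :=
  Function.update (fun _ => 0) i 1

/-- The lifted CHSH expression `I^{i,j}_{0|0}(p) =
p(0|0) − p(eᵢ|eᵢ) − p(eⱼ|eⱼ) − p(0|eᵢ+eⱼ)`. -/
def chshLift {n : ℕ} (i j : Fin n) (p : (Fin n → Fin 2) → (Fin n → Fin 2) → ℝ) : ℝ :=
  p (fun _ => 0) (fun _ => 0) - p (unitVec n i) (unitVec n i)
    - p (unitVec n j) (unitVec n j)
    - p (fun _ => 0) (Function.update (unitVec n i) j 1)

/-- The total outcome weight of party `i` does not depend on its input. -/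
theorem IsNSCorr.apply_zero_le {ι : Type} [Fintype ι] [DecidableEq ι]
    {p : (ι → Fin 2) → (ι → Fin 2) → ℝ} (hp : IsNSCorr 2 2 p) (i : ι) :
    p (fun _ => 0) (fun _ => 0) ≤
      p (Function.update (fun _ => 0) i 1) (Function.update (fun _ => 0) i 1) +
        p (fun _ => 0) (Function.update (fun _ => 0) i 1) := by
  have h := hp.2.2 i (fun _ => 0) (fun _ => 0) (Function.update (fun _ => 0) i 1)
    (fun j hj => by simp [hj])
  have h0 : Function.update (fun _ : ι => (0 : Fin 2)) i 0 = fun _ => 0 :=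
    Function.update_eq_self i (fun _ : ι => (0 : Fin 2))
  simp only [Fin.sum_univ_two, h0] at h
  linarith [hp.1 (Function.update (fun _ => 0) i 1) (fun _ => 0)]

/-- The CHSH inequality for a product of two unnormalized one-party boxes. -/
theorem chsh_product_nonpos {a₀ a₁ a₂ b₀ b₁ b₂ : ℝ} (ha₀ : 0 ≤ a₀) (ha₁ : 0 ≤ a₁)
    (hb₀ : 0 ≤ b₀) (hb₁ : 0 ≤ b₁) (hb₂ : 0 ≤ b₂) (ha₂ : 0 ≤ a₂)
    (ha : a₀ ≤ a₁ + a₂) (hb : b₀ ≤ b₁ + b₂) :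
    a₀ * b₀ - a₁ * b₀ - a₀ * b₁ - a₂ * b₂ ≤ 0 := by
  rcases le_total a₂ a₀ with h | h
  · nlinarith [mul_nonneg ha₂ (sub_nonneg.2 hb), mul_nonneg hb₀ (sub_nonneg.2 ha),
      mul_nonneg hb₁ (sub_nonneg.2 h)]
  · nlinarith [mul_nonneg ha₀ (sub_nonneg.2 hb), mul_nonneg ha₁ hb₀,
      mul_nonneg hb₂ (sub_nonneg.2 h)]

/-- The product of block correlations over the fibers of `π`. -/
def blockProd {n : ℕ} (π : Fin n → Fin n)
    (P : (t : Fin n) → ({i : Fin n // π i = t} → Fin 2) → ({i : Fin n // π i = t} → Fin 2) → ℝ)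
    (a x : Fin n → Fin 2) : ℝ :=
  ∏ t, P t (fun i => a i.1) (fun i => x i.1)

section blockProd

variable {n : ℕ} {π : Fin n → Fin n}
  {P : (t : Fin n) → ({i : Fin n // π i = t} → Fin 2) → ({i : Fin n // π i = t} → Fin 2) → ℝ}

theorem blockProd_nonneg (hP : ∀ t, IsNSCorr 2 2 (P t)) (a x : Fin n → Fin 2) :
    0 ≤ blockProd π P a x :=
  Finset.prod_nonneg fun t _ => (hP t).1 _ _

/-- If `i` and `j` lie in different blocks, only their two block factors matter for tuples
vanishing elsewhere. -/
theorem blockProd_eq_mul {i j : Fin n} (hij : π i ≠ π j) {a x : Fin n → Fin 2}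
    (ha : ∀ l, l ≠ i → l ≠ j → a l = 0) (hx : ∀ l, l ≠ i → l ≠ j → x l = 0) :
    blockProd π P a x =
      P (π i) (fun l => a l.1) (fun l => x l.1) * P (π j) (fun l => a l.1) (fun l => x l.1) *
        ∏ t ∈ (Finset.univ.erase (π i)).erase (π j), P t (fun _ => 0) (fun _ => 0) := by
  have hj : π j ∈ Finset.univ.erase (π i) := by simp [hij.symm]
  rw [blockProd, ← Finset.mul_prod_erase _ _ (Finset.mem_univ (π i)),
    ← Finset.mul_prod_erase _ _ hj, mul_assoc]
  congr 2
  refine Finset.prod_congr rfl fun t ht => ?_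
  simp only [Finset.mem_erase, Finset.mem_univ, and_true] at ht
  have hne (l : {l // π l = t}) : l.1 ≠ i ∧ l.1 ≠ j :=
    ⟨fun h => ht.2 (by rw [← l.2, h]), fun h => ht.1 (by rw [← l.2, h])⟩
  congr 1
  · exact funext fun l => ha l (hne l).1 (hne l).2
  · exact funext fun l => hx l (hne l).1 (hne l).2

theorem chshLift_blockProd_nonpos (hP : ∀ t, IsNSCorr 2 2 (P t)) {i j : Fin n}
    (hij : π i ≠ π j) : chshLift i j (blockProd π P) ≤ 0 := by
  have hne : i ≠ j := fun h => hij (by rw [h])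
  have hii : (fun l : {l // π l = π i} => unitVec n i l.1) =
      Function.update (fun _ => 0) ⟨i, rfl⟩ 1 := by
    funext l; simp [unitVec, Function.update_apply, Subtype.ext_iff]
  have hjj : (fun l : {l // π l = π j} => unitVec n j l.1) =
      Function.update (fun _ => 0) ⟨j, rfl⟩ 1 := by
    funext l; simp [unitVec, Function.update_apply, Subtype.ext_iff]
  have hji : (fun l : {l // π l = π j} => unitVec n i l.1) = fun _ => 0 := by
    funext l
    have : l.1 ≠ i := fun h => hij (by rw [← h, l.2])
    simp [unitVec, this]
  have hij' : (fun l : {l // π l = π i} => unitVec n j l.1) = fun _ => 0 := by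
    funext l
    have : l.1 ≠ j := fun h => hij (by rw [← h, l.2])
    simp [unitVec, this]
  have hi2 : (fun l : {l // π l = π i} => Function.update (unitVec n i) j 1 l.1) =
      Function.update (fun _ => 0) ⟨i, rfl⟩ 1 := by
    rw [← hii]
    funext l
    have : l.1 ≠ j := fun h => hij (by rw [← h, l.2])
    simp [this]
  have hj2 : (fun l : {l // π l = π j} => Function.update (unitVec n i) j 1 l.1) =
      Function.update (fun _ => 0) ⟨j, rfl⟩ 1 := by
    rw [← hjj]
    funext l
    have : l.1 ≠ i := fun h => hij (by rw [← h, l.2])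
    simp [unitVec, Function.update_apply, this]
  have hui : ∀ l, l ≠ i → l ≠ j → unitVec n i l = 0 := fun l hl _ => by simp [unitVec, hl]
  have huj : ∀ l, l ≠ i → l ≠ j → unitVec n j l = 0 := fun l _ hl => by simp [unitVec, hl]
  have huij : ∀ l, l ≠ i → l ≠ j → Function.update (unitVec n i) j 1 l = 0 :=
    fun l hl hl' => by simp [unitVec, hl, hl']
  have h0 : ∀ l, l ≠ i → l ≠ j → (fun _ : Fin n => (0 : Fin 2)) l = 0 := fun _ _ _ => rfl
  rw [chshLift, blockProd_eq_mul hij h0 h0, blockProd_eq_mul hij hui hui,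
    blockProd_eq_mul hij huj huj, blockProd_eq_mul hij h0 huij, hii, hjj, hji, hij', hi2, hj2,
    ← sub_mul, ← sub_mul, ← sub_mul]
  exact mul_nonpos_of_nonpos_of_nonneg
    (chsh_product_nonpos ((hP _).1 _ _) ((hP _).1 _ _) ((hP _).1 _ _) ((hP _).1 _ _)
      ((hP _).1 _ _) ((hP _).1 _ _) ((hP _).apply_zero_le _) ((hP _).apply_zero_le _))
    (Finset.prod_nonneg fun t _ => (hP t).1 _ _)

end blockProd

theorem chshLift_le {n : ℕ} {p : (Fin n → Fin 2) → (Fin n → Fin 2) → ℝ}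
    (hp : ∀ a x, 0 ≤ p a x) (i j : Fin n) :
    chshLift i j p ≤ p (fun _ => 0) (fun _ => 0) - p (unitVec n i) (unitVec n i) := by
  unfold chshLift
  linarith [hp (unitVec n j) (unitVec n j), hp (fun _ => 0) (Function.update (unitVec n i) j 1)]

/-- The star of lifted CHSH inequalities centered at party `o`, with bound `k - 1`. -/
def StarBound {n : ℕ} (o : Fin n) (k : ℕ) (p : (Fin n → Fin 2) → (Fin n → Fin 2) → ℝ) : Prop :=
  ∑ j ∈ Finset.univ.erase o, chshLift o j p ≤
    ((k : ℝ) - 1) * (p (fun _ => 0) (fun _ => 0) - p (unitVec n o) (unitVec n o))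

theorem StarBound.mixture {n N k : ℕ} {o : Fin n} {q : Fin N → ℝ}
    {p : (Fin n → Fin 2) → (Fin n → Fin 2) → ℝ}
    {ps : Fin N → (Fin n → Fin 2) → (Fin n → Fin 2) → ℝ} (hq : ∀ l, 0 ≤ q l)
    (hps : ∀ l, StarBound o k (ps l)) (hp : ∀ a x, p a x = ∑ l, q l * ps l a x) :
    StarBound o k p := by
  have hI (j : Fin n) : chshLift o j p = ∑ l, q l * chshLift o j (ps l) := by
    simp only [chshLift, hp, ← Finset.sum_sub_distrib, mul_sub]
  have hD : ((k : ℝ) - 1) * (p (fun _ => 0) (fun _ => 0) - p (unitVec n o) (unitVec n o)) =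
      ∑ l, q l * (((k : ℝ) - 1) *
        (ps l (fun _ => 0) (fun _ => 0) - ps l (unitVec n o) (unitVec n o))) := by
    simp only [hp, ← Finset.sum_sub_distrib, Finset.mul_sum]
    exact Finset.sum_congr rfl fun l _ => by ring
  unfold StarBound
  simp only [hI]
  rw [Finset.sum_comm, hD]
  refine Finset.sum_le_sum fun l _ => ?_
  rw [← Finset.mul_sum]
  exact mul_le_mul_of_nonneg_left (hps l) (hq l)

theorem starBound_blockProd {n k : ℕ} (hkn : k ≤ n) (o : Fin n) {π : Fin n → Fin n}
    {P : (t : Fin n) → ({i : Fin n // π i = t} → Fin 2) → ({i : Fin n // π i = t} → Fin 2) → ℝ}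
    (hP : ∀ t, IsNSCorr 2 2 (P t))
    (hcard : (Finset.univ.filter fun i => π i = π o).card ≤ k) :
    StarBound o k (blockProd π P) := by
  have hle := chshLift_le (blockProd_nonneg hP) o
  unfold StarBound
  set D := blockProd π P (fun _ => 0) (fun _ => 0) - blockProd π P (unitVec n o) (unitVec n o)
  rcases le_total 0 D with hD | hD
  · calc ∑ j ∈ Finset.univ.erase o, chshLift o j (blockProd π P)
        ≤ ∑ j ∈ Finset.univ.erase o, if π j = π o then D else 0 := by
          refine Finset.sum_le_sum fun j _ => ?_
          split_ifs with h
          · exact hle j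
          · exact chshLift_blockProd_nonpos hP (Ne.symm h)
      _ = (((Finset.univ.filter fun i => π i = π o).card : ℝ) - 1) * D := by
          have h := Finset.add_sum_erase Finset.univ (fun j => if π j = π o then D else 0)
            (Finset.mem_univ o)
          rw [if_pos rfl, ← Finset.sum_filter (s := Finset.univ),
            Finset.sum_const, nsmul_eq_mul] at h
          linarith
      _ ≤ ((k : ℝ) - 1) * D := by gcongr
  · calc ∑ j ∈ Finset.univ.erase o, chshLift o j (blockProd π P)
        ≤ ∑ j ∈ Finset.univ.erase o, D := Finset.sum_le_sum fun j _ => hle j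
      _ = ((n : ℝ) - 1) * D := by
          have h := Finset.add_sum_erase Finset.univ (fun _ => D) (Finset.mem_univ o)
          rw [Finset.sum_const (s := Finset.univ), Finset.card_univ, Fintype.card_fin, nsmul_eq_mul] at h
          linarith
      _ ≤ ((k : ℝ) - 1) * D := mul_le_mul_of_nonpos_right (by gcongr) hD

theorem IsKProducible.starBound {n k : ℕ} (hkn : k ≤ n) (o : Fin n)
    {p : (Fin n → Fin 2) → (Fin n → Fin 2) → ℝ} (hp : IsKProducible n 2 2 k p) :
    StarBound o k p := by
  obtain ⟨N, q, ps, π, hq, -, h, hp⟩ := hp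
  refine StarBound.mixture hq (fun l => ?_) hp
  obtain ⟨hcard, M, r, pB, hr, -, hB, hps⟩ := h l
  exact StarBound.mixture hr (fun m => starBound_blockProd hkn o (hB m) (hcard _)) hps

/-- every `k`-producible `n`-partite correlation (2 inputs / 2 outcomes
per party) satisfies `∑_{j=2}^n I^{1,j}_{0|0}(p) ≤ (k−1)[p(0|0) − p(e₁|e₁)]`. -/
theorem statement6 (n k : ℕ) (hn : 2 ≤ n) (hk : 1 ≤ k) (hkn : k ≤ n)
    (p : (Fin n → Fin 2) → (Fin n → Fin 2) → ℝ)
    (hp : IsKProducible n 2 2 k p) :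
    ∑ j ∈ Finset.univ.filter (fun j : Fin n => (j : ℕ) ≠ 0),
        chshLift (⟨0, by omega⟩ : Fin n) j p ≤
      ((k : ℝ) - 1) *
        (p (fun _ => 0) (fun _ => 0) -
          p (unitVec n ⟨0, by omega⟩) (unitVec n ⟨0, by omega⟩)) := by
  have h := hp.starBound hkn ⟨0, by omega⟩
  have hf : Finset.univ.filter (fun j : Fin n => (j : ℕ) ≠ 0) =
      Finset.univ.erase ⟨0, by omega⟩ := by
    ext j
    simp [Fin.ext_iff]
  rw [hf]
  exact h
end

section
/- Every bilocal tripartite correlation p with 2 inputs and 3 outcomes per party satisfies I^{1,2}(p) + I^{1,3}(p) ≤ [p(001|000) + p(010|000) + p(011|000) + p(100|000) + p(101|000) + p(110|000)] − [p(001|100) + p(010|100) + p(011|100) + p(100|100) + p(101|100) + p(110|100)], where I^{i,j} = J₃^{i,j}(1|0) + J̃₃^{i,j}(0|0) is built from the three-outcome CGLMP-type expressions J₃ and J̃₃ defined in the context. -/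
/-- The outcome tuple assigning `u` to party `i`, `v` to party `j`, and the fixed
outcome `γ` to the remaining party. -/
def outT (i j : Fin 3) (γ u v : Fin 3) : Fin 3 → Fin 3 :=
  fun t => if t = i then u else if t = j then v else γ

/-- The input tuple assigning `u` to party `i`, `v` to party `j`, and input `0` to
the remaining party. -/
def inpT (i j : Fin 3) (u v : Fin 2) : Fin 3 → Fin 2 :=
  fun t => if t = i then u else if t = j then v else 0

/-- The CGLMP-type expression `J₃` on parties `i, j`, lifted with the remaining
party's input fixed to `0` and outcome fixed to `γ`. -/
def J3lift (i j : Fin 3) (γ : Fin 3) (p : (Fin 3 → Fin 3) → (Fin 3 → Fin 2) → ℝ) : ℝ :=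
  p (outT i j γ 0 1) (inpT i j 0 0) + p (outT i j γ 0 0) (inpT i j 0 0)
    + p (outT i j γ 1 0) (inpT i j 0 0)
    - p (outT i j γ 0 1) (inpT i j 0 1) - p (outT i j γ 0 2) (inpT i j 0 1)
    - p (outT i j γ 1 2) (inpT i j 0 1)
    - p (outT i j γ 1 0) (inpT i j 1 1) - p (outT i j γ 2 0) (inpT i j 1 1)
    - p (outT i j γ 2 1) (inpT i j 1 1)
    - p (outT i j γ 0 1) (inpT i j 1 0) - p (outT i j γ 0 0) (inpT i j 1 0)
    - p (outT i j γ 1 0) (inpT i j 1 0)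

/-- The expression `J̃₃` (obtained from `J₃` by exchanging outcomes `0 ↔ 1` of both
parties) on parties `i, j`, lifted with the remaining party's input fixed to `0` and
outcome fixed to `γ`. -/
def J3tlift (i j : Fin 3) (γ : Fin 3) (p : (Fin 3 → Fin 3) → (Fin 3 → Fin 2) → ℝ) : ℝ :=
  p (outT i j γ 1 0) (inpT i j 0 0) + p (outT i j γ 1 1) (inpT i j 0 0)
    + p (outT i j γ 0 1) (inpT i j 0 0)
    - p (outT i j γ 1 0) (inpT i j 0 1) - p (outT i j γ 1 2) (inpT i j 0 1)
    - p (outT i j γ 0 2) (inpT i j 0 1)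
    - p (outT i j γ 0 1) (inpT i j 1 1) - p (outT i j γ 2 1) (inpT i j 1 1)
    - p (outT i j γ 2 0) (inpT i j 1 1)
    - p (outT i j γ 1 0) (inpT i j 1 0) - p (outT i j γ 1 1) (inpT i j 1 0)
    - p (outT i j γ 0 1) (inpT i j 1 0)

/-- `I^{i,j} = J₃^{i,j}(1|0) + J̃₃^{i,j}(0|0)`. -/
def Iij (i j : Fin 3) (p : (Fin 3 → Fin 3) → (Fin 3 → Fin 2) → ℝ) : ℝ :=
  J3lift i j 1 p + J3tlift i j 0 p

/-- Right-hand side minus left-hand side of the inequality, as a linear functional of `p`. -/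
def bilocalGap : ((Fin 3 → Fin 3) → (Fin 3 → Fin 2) → ℝ) →ₗ[ℝ] ℝ where
  toFun p :=
    (p ![0, 0, 1] (fun _ => 0) + p ![0, 1, 0] (fun _ => 0) + p ![0, 1, 1] (fun _ => 0)
          + p ![1, 0, 0] (fun _ => 0) + p ![1, 0, 1] (fun _ => 0)
          + p ![1, 1, 0] (fun _ => 0))
        - (p ![0, 0, 1] ![1, 0, 0] + p ![0, 1, 0] ![1, 0, 0] + p ![0, 1, 1] ![1, 0, 0]
            + p ![1, 0, 0] ![1, 0, 0] + p ![1, 0, 1] ![1, 0, 0]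
            + p ![1, 1, 0] ![1, 0, 0])
      - (Iij 0 1 p + Iij 0 2 p)
  map_add' p q := by simp only [Iij, J3lift, J3tlift, Pi.add_apply]; ring
  map_smul' c p := by
    simp only [Iij, J3lift, J3tlift, Pi.smul_apply, smul_eq_mul, RingHom.id_apply]; ring

/-- If a correlation is a nonnegative combination of correlations with nonnegative gap, then it has
nonnegative gap. -/
theorem bilocalGap_nonneg_of_sum {κ : Type*} [Fintype κ] {q : κ → ℝ}
    {ps : κ → (Fin 3 → Fin 3) → (Fin 3 → Fin 2) → ℝ} {p : (Fin 3 → Fin 3) → (Fin 3 → Fin 2) → ℝ}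
    (hq : ∀ l, 0 ≤ q l) (hps : ∀ l, 0 ≤ bilocalGap (ps l))
    (hp : ∀ a x, p a x = ∑ l, q l * ps l a x) :
    0 ≤ bilocalGap p := by
  have h : p = ∑ l, q l • ps l := by
    ext a x
    simp [hp, Finset.sum_apply]
  rw [h, map_sum]
  exact Finset.sum_nonneg fun l _ => by
    rw [map_smul]
    exact mul_nonneg (hq l) (hps l)

/-- Nonnegativity and the no-signaling conditions for a bipartite box `P a b x y`. -/
structure IsNSBox {d m : ℕ} (P : Fin d → Fin d → Fin m → Fin m → ℝ) : Prop where
  nonneg : ∀ a b x y, 0 ≤ P a b x y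
  left : ∀ a x y y', ∑ b, P a b x y = ∑ b, P a b x y'
  right : ∀ b x x' y, ∑ a, P a b x y = ∑ a, P a b x' y

/-- The gap is nonnegative when party `i` answers deterministically by `s` and parties `j`, `k`
share a no-signaling box. -/
theorem bilocalGap_det_nonneg {P : Fin 3 → Fin 3 → Fin 2 → Fin 2 → ℝ} (hP : IsNSBox P)
    {i j k : Fin 3}
    (h : (i = 0 ∧ j = 1 ∧ k = 2) ∨ (i = 1 ∧ j = 0 ∧ k = 2) ∨ (i = 2 ∧ j = 0 ∧ k = 1))
    (s : Fin 3 × Fin 3) :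
    0 ≤ bilocalGap fun a x =>
      (if a i = ![s.1, s.2] (x i) then 1 else 0) * P (a j) (a k) (x j) (x k) := by
  obtain ⟨hn, hl, hr⟩ := hP
  have l0 := fun a => hl a 0 0 1
  have l1 := fun a => hl a 1 0 1
  have r0 := fun a => hr a 0 1 0
  have r1 := fun a => hr a 0 1 1
  simp only [Fin.forall_fin_succ, Fin.sum_univ_three, IsEmpty.forall_iff, and_true, Fin.isValue,
    Fin.succ_zero_eq_one, Fin.succ_one_eq_two] at hn l0 l1 r0 r1
  obtain ⟨s0, s1⟩ := s
  rcases h with ⟨rfl, rfl, rfl⟩ | ⟨rfl, rfl, rfl⟩ | ⟨rfl, rfl, rfl⟩ <;>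
    fin_cases s0 <;> fin_cases s1 <;>
    simp [bilocalGap, Iij, J3lift, J3tlift, outT, inpT] <;> linarith

/-- The gap is nonnegative on the product of a single-party box and a no-signaling bipartite
box. -/
theorem bilocalGap_prod_nonneg {P : Fin 3 → Fin 3 → Fin 2 → Fin 2 → ℝ} (hP : IsNSBox P)
    {u : Fin 3 → Fin 2 → ℝ} (hu : ∀ a x, 0 ≤ u a x) (hu1 : ∀ x, ∑ a, u a x = 1) {i j k : Fin 3}
    (h : (i = 0 ∧ j = 1 ∧ k = 2) ∨ (i = 1 ∧ j = 0 ∧ k = 2) ∨ (i = 2 ∧ j = 0 ∧ k = 1)) :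
    0 ≤ bilocalGap fun a x => u (a i) (x i) * P (a j) (a k) (x j) (x k) := by
  have hdet (a : Fin 3) (x : Fin 2) :
      u a x = ∑ s : Fin 3 × Fin 3, u s.1 0 * u s.2 1 * if a = ![s.1, s.2] x then 1 else 0 := by
    have h0 := hu1 0
    have h1 := hu1 1
    simp only [Fin.sum_univ_three] at h0 h1
    fin_cases x
    · fin_cases a <;> simp [Fintype.sum_prod_type, Fin.sum_univ_three] <;>
        rw [← mul_add, ← mul_add, h1, mul_one]
    · fin_cases a <;> simp [Fintype.sum_prod_type, Fin.sum_univ_three] <;>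
        rw [← add_mul, ← add_mul, h0, one_mul]
  refine bilocalGap_nonneg_of_sum (q := fun s : Fin 3 × Fin 3 => u s.1 0 * u s.2 1)
    (fun s => mul_nonneg (hu _ _) (hu _ _)) (fun s => bilocalGap_det_nonneg hP h s) fun a x => ?_
  rw [hdet, Finset.sum_mul]
  exact Finset.sum_congr rfl fun s _ => mul_assoc _ _ _

/-- A correlation of two parties, in curried form, is a no-signaling box. -/
theorem IsNSCorr.isNSBox {ι : Type} [Fintype ι] [DecidableEq ι] {d m : ℕ}
    {p : (ι → Fin d) → (ι → Fin m) → ℝ} (hp : IsNSCorr d m p) {j k : ι} (hjk : j ≠ k)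
    (hι : ∀ i, i = j ∨ i = k) :
    IsNSBox fun a b x y => p (fun i => if i = j then a else b) (fun i => if i = j then x else y) where
  nonneg a b x y := hp.1 _ _
  left a x y y' := by
    have key (v : Fin d) : (fun i => if i = j then a else v) =
        Function.update (fun _ => a) k v := by
      ext i
      rcases hι i with rfl | rfl <;> simp [hjk, hjk.symm]
    simp only [key]
    refine hp.2.2 k _ _ _ fun i hi => ?_
    simp [(hι i).resolve_right hi]
  right b x x' y := by
    have key (v : Fin d) : (fun i => if i = j then v else b) =
        Function.update (fun _ => b) j v := by
      ext i
      simp [Function.update_apply]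
    simp only [key]
    refine hp.2.2 j _ _ _ fun i hi => ?_
    simp [hi]

/-- Normalization of a correlation of a single party, in curried form. -/
theorem IsNSCorr.sum_const_eq_one {ι : Type} [Fintype ι] [DecidableEq ι] {d m : ℕ}
    {p : (ι → Fin d) → (ι → Fin m) → ℝ} (hp : IsNSCorr d m p) {i : ι} (hι : ∀ j, j = i)
    (x : Fin m) : ∑ a, p (fun _ => a) (fun _ => x) = 1 := by
  let _ : Unique ι := ⟨⟨i⟩, hι⟩
  rw [← hp.2.1 fun _ => x]
  exact Fintype.sum_equiv (Equiv.funUnique ι (Fin d)).symm _ _ fun a => rfl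

/-- The gap is nonnegative on a product of a correlation of party `i` and a correlation of
parties `j` and `k`. -/
theorem bilocalGap_corr_nonneg {A B : Fin 3 → Prop} [Fintype {t // A t}] [Fintype {t // B t}]
    {i j k : Fin 3}
    (h : (i = 0 ∧ j = 1 ∧ k = 2) ∨ (i = 1 ∧ j = 0 ∧ k = 2) ∨ (i = 2 ∧ j = 0 ∧ k = 1))
    (hA : ∀ t, A t ↔ t = i) (hB : ∀ t, B t ↔ t ≠ i)
    {p : ({t // A t} → Fin 3) → ({t // A t} → Fin 2) → ℝ}
    {r : ({t // B t} → Fin 3) → ({t // B t} → Fin 2) → ℝ}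
    (hp : IsNSCorr 3 2 p) (hr : IsNSCorr 3 2 r) :
    0 ≤ bilocalGap fun a x => p (fun t => a t.1) (fun t => x t.1) *
      r (fun t => a t.1) (fun t => x t.1) := by
  have hBjk (t : Fin 3) : B t ↔ t = j ∨ t = k := by
    rw [hB]; revert t; rcases h with ⟨rfl, rfl, rfl⟩ | ⟨rfl, rfl, rfl⟩ | ⟨rfl, rfl, rfl⟩ <;> decide
  have hjk : j ≠ k := by
    rcases h with ⟨rfl, rfl, rfl⟩ | ⟨rfl, rfl, rfl⟩ | ⟨rfl, rfl, rfl⟩ <;> decide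
  have hbox := hr.isNSBox (j := ⟨j, (hBjk j).2 (.inl rfl)⟩) (k := ⟨k, (hBjk k).2 (.inr rfl)⟩)
    (by simpa using hjk) fun t => by simpa [Subtype.ext_iff] using (hBjk t).1 t.2
  have hsum := hp.sum_const_eq_one (i := ⟨i, (hA i).2 rfl⟩)
    fun t => by simpa [Subtype.ext_iff] using (hA t).1 t.2
  have hA' {β : Type} (f : Fin 3 → β) : (fun t : {t // A t} => f t) = fun _ => f i :=
    funext fun t => congrArg f ((hA t).1 t.2)
  have hB' {β : Type} (f : Fin 3 → β) : (fun t : {t // B t} => f t) =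
      fun t => if t = ⟨j, (hBjk j).2 (.inl rfl)⟩ then f j else f k := by
    funext ⟨t, ht⟩
    rcases (hBjk t).1 ht with rfl | rfl <;> simp [hjk.symm]
  simp only [hA', hB']
  exact bilocalGap_prod_nonneg hbox (fun _ _ => hp.1 _ _) hsum h

/-- The gap is nonnegative on correlations that are local across a nontrivial bipartition. -/
theorem IsLocalAcross.bilocalGap_nonneg {S : Finset (Fin 3)} (hS : S.Nonempty)
    (hS' : S ≠ Finset.univ) {p : (Fin 3 → Fin 3) → (Fin 3 → Fin 2) → ℝ}
    (hp : IsLocalAcross 3 3 2 S p) : 0 ≤ bilocalGap p := by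
  obtain ⟨N, q, pS, pT, hq, -, hpS, hpT, hsum⟩ := hp
  refine bilocalGap_nonneg_of_sum hq (fun l => ?_)
    fun a x => (hsum a x).trans (Finset.sum_congr rfl fun l _ => mul_assoc _ _ _)
  have hsplit : ∀ T : Finset (Fin 3), T.Nonempty → T ≠ Finset.univ →
      ∃ i, (∀ t, t ∈ T ↔ t = i) ∨ ∀ t, t ∈ T ↔ t ≠ i := by decide
  obtain ⟨i, hi⟩ := hsplit S hS hS'
  obtain ⟨j, k, h⟩ : ∃ j k : Fin 3,
      (i = 0 ∧ j = 1 ∧ k = 2) ∨ (i = 1 ∧ j = 0 ∧ k = 2) ∨ (i = 2 ∧ j = 0 ∧ k = 1) := by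
    clear hi; revert i; decide
  rcases hi with hi | hi
  · exact bilocalGap_corr_nonneg h hi (fun t => (hi t).not) (hpS l) (hpT l)
  · simp only [mul_comm (pS l _ _)]
    exact bilocalGap_corr_nonneg h (fun t => (hi t).not.trans not_not) hi (hpT l) (hpS l)

/-- every bilocal tripartite correlation with 2 inputs and 3 outcomes
per party satisfies `I^{1,2}(p) + I^{1,3}(p) ≤ I₊(p) − T(p)`, where `I₊(p)` is the sum
of the six probabilities `p(a|000)` and `T(p)` the sum of the six probabilities
`p(a|100)`, for `a ∈ {001, 010, 011, 100, 101, 110}`. -/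
theorem statement18 (p : (Fin 3 → Fin 3) → (Fin 3 → Fin 2) → ℝ)
    (hp : IsBilocal 3 3 2 p) :
    Iij 0 1 p + Iij 0 2 p ≤
      (p ![0, 0, 1] (fun _ => 0) + p ![0, 1, 0] (fun _ => 0) + p ![0, 1, 1] (fun _ => 0)
          + p ![1, 0, 0] (fun _ => 0) + p ![1, 0, 1] (fun _ => 0)
          + p ![1, 1, 0] (fun _ => 0))
        - (p ![0, 0, 1] ![1, 0, 0] + p ![0, 1, 0] ![1, 0, 0] + p ![0, 1, 1] ![1, 0, 0]
            + p ![1, 0, 0] ![1, 0, 0] + p ![1, 0, 1] ![1, 0, 0]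
            + p ![1, 1, 0] ![1, 0, 0]) := by
  obtain ⟨N, q, ps, S, hq, -, hps, hsum⟩ := hp
  exact sub_nonneg.1 (bilocalGap_nonneg_of_sum hq
    (fun l => (hps l).2.2.bilocalGap_nonneg (hps l).1 (hps l).2.1) hsum)
end
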